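/- arXiv:1910.05634 — 3 statements merged into one kernel-verified Lean document; each statement's English description precedes it below -/
import Mathlib

section
/- If C is an (n,k)_q MDS code with q ≤ k, then n ≤ k + 1. -/
/-- `C ⊆ A^n` is an `(n,k)_q` MDS code: it has `q^k` codewords and its minimum
Hamming distance equals `n - k + 1`. -/
def IsMDS {A : Type*} [DecidableEq A] {n : ℕ} (q k : ℕ) (C : Finset (Fin n → A)) : Prop :=
  C.card = q ^ k ∧
    (∀ x ∈ C, ∀ y ∈ C, x ≠ y → n - k + 1 ≤ hammingDist x y) ∧
    (∃ x ∈ C, ∃ y ∈ C, x ≠ y ∧ hammingDist x y = n - k + 1)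

/-- The Hamming weight of a word `c : Fin n → A` relative to a distinguished
zero element `z` of the alphabet: the number of coordinates different from `z`. -/
def wt {A : Type*} [DecidableEq A] {n : ℕ} (z : A) (c : Fin n → A) : ℕ :=
  (Finset.univ.filter fun i => c i ≠ z).card

/-- Two codes are equivalent if one is obtained from the other by a permutation
`σ` of the coordinate positions together with a permutation `π i` of the alphabet
applied in each position `i`. -/
def CodeEquiv {A : Type*} [DecidableEq A] {n : ℕ} (C C' : Finset (Fin n → A)) : Prop :=
  ∃ (σ : Equiv.Perm (Fin n)) (π : Fin n → Equiv.Perm A),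
    C' = C.image fun c => fun i => π i (c (σ i))

/-- Codewords agreeing on at least `k` coordinates are equal. -/
theorem IsMDS.eq_of_agree {A : Type*} [DecidableEq A] {q n k : ℕ} {C : Finset (Fin n → A)}
    (hC : IsMDS q k C) {x y : Fin n → A} (hx : x ∈ C) (hy : y ∈ C)
    {S : Finset (Fin n)} (hS : k ≤ S.card) (h : ∀ i ∈ S, x i = y i) : x = y := by
  by_contra hne
  have h₁ := hC.2.1 x hx y hy hne
  have h₂ : hammingDist x y ≤ Sᶜ.card := by
    refine Finset.card_le_card fun i hi => ?_
    rw [Finset.mem_compl]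
    exact fun hiS => (Finset.mem_filter.1 hi).2 (h i hiS)
  rw [Finset.card_compl, Fintype.card_fin] at h₂
  omega

/-- Any `k` coordinates form an information set: every assignment of symbols to them
extends to a codeword. -/
theorem IsMDS.exists_extend {A : Type*} [Fintype A] [DecidableEq A] {q n k : ℕ}
    {C : Finset (Fin n → A)} (hA : Fintype.card A = q) (hC : IsMDS q k C)
    {S : Finset (Fin n)} (hS : S.card = k) (f : Fin n → A) :
    ∃ x ∈ C, ∀ i ∈ S, x i = f i := by
  let r : C → S → A := fun x i => x.1 i
  have hr : Function.Injective r := fun x y h =>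
    Subtype.ext (hC.eq_of_agree x.2 y.2 hS.ge fun i hi => congrFun h ⟨i, hi⟩)
  have hb : Function.Bijective r :=
    (Fintype.bijective_iff_injective_and_card r).2 ⟨hr, by simp [hC.1, hA, hS]⟩
  obtain ⟨x, hx⟩ := hb.2 fun i => f i
  exact ⟨x, x.2, fun i hi => congrFun hx ⟨i, hi⟩⟩

/-- an `(n,k)_q` MDS code with `q ≤ k` has `n ≤ k + 1`. -/
theorem stmt_6 {A : Type*} [Fintype A] [DecidableEq A] {q n k : ℕ}
    (hq : 2 ≤ q) (hA : Fintype.card A = q)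
    (C : Finset (Fin n → A)) (hC : IsMDS q k C) (hqk : q ≤ k) :
    n ≤ k + 1 := by
  by_contra! hn
  obtain ⟨c, hc, -⟩ := hC.2.2
  obtain ⟨U, -, hU⟩ := Finset.exists_subset_card_eq
    (s := (Finset.univ : Finset (Fin n))) (n := k + 2) (by rw [Finset.card_fin]; omega)
  obtain ⟨i₀, V, hi₀, rfl, hV⟩ := Finset.card_eq_succ.1 hU
  obtain ⟨i₁, T, hi₁, rfl, hT⟩ := Finset.card_eq_succ.1 hV
  simp only [Finset.mem_insert, not_or] at hi₀
  have : Nontrivial A := Fintype.one_lt_card_iff_nontrivial.1 (by omega)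
  obtain ⟨a, ha⟩ := exists_ne (c i₀)
  have hex : ∀ j ∈ T, ∃ x ∈ C, x i₀ = a ∧ ∀ i ∈ T.erase j, x i = c i := by
    intro j hj
    have hnot : i₀ ∉ T.erase j := fun h => hi₀.2 (Finset.mem_of_mem_erase h)
    obtain ⟨x, hx, h⟩ := hC.exists_extend hA (S := insert i₀ (T.erase j))
      (by rw [Finset.card_insert_of_notMem hnot, Finset.card_erase_of_mem hj]; omega)
      (Function.update c i₀ a)
    refine ⟨x, hx, by simpa using h i₀ (Finset.mem_insert_self _ _), fun i hi => ?_⟩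
    rw [h i (Finset.mem_insert_of_mem hi),
      Function.update_of_ne (ne_of_mem_of_not_mem hi hnot)]
  choose! x hxC hx₀ hxT using hex
  have hne : ∀ j ∈ T, x j ≠ c := fun j hj h => ha (by rw [← hx₀ j hj, h])
  have hmaps : ∀ j ∈ T, x j i₁ ∈ Finset.univ.erase (c i₁) := by
    intro j hj
    refine Finset.mem_erase.2 ⟨fun h => hne j hj ?_, Finset.mem_univ _⟩
    refine hC.eq_of_agree (hxC j hj) hc (S := insert i₁ (T.erase j)) ?_ ?_
    · rw [Finset.card_insert_of_notMem fun h => hi₁ (Finset.mem_of_mem_erase h),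
        Finset.card_erase_of_mem hj]
      omega
    · intro i hi
      rcases Finset.mem_insert.1 hi with rfl | hi
      exacts [h, hxT j hj i hi]
  obtain ⟨j, hj, l, hl, hjl, heq⟩ := Finset.exists_ne_map_eq_of_card_lt_of_maps_to
    (by rw [Finset.card_erase_of_mem (Finset.mem_univ _), Finset.card_univ]; omega) hmaps
  have hxx : x j = x l := by
    refine hC.eq_of_agree (hxC j hj) (hxC l hl)
      (S := insert i₀ (insert i₁ ((T.erase j).erase l))) ?_ ?_
    · have hlj : l ∈ T.erase j := Finset.mem_erase.2 ⟨hjl.symm, hl⟩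
      rw [Finset.card_insert_of_notMem (by simp [hi₀]),
        Finset.card_insert_of_notMem (by simp [hi₁]),
        Finset.card_erase_of_mem hlj, Finset.card_erase_of_mem hj]
      omega
    · intro i hi
      rcases Finset.mem_insert.1 hi with rfl | hi
      · rw [hx₀ j hj, hx₀ l hl]
      rcases Finset.mem_insert.1 hi with rfl | hi
      · exact heq
      · simp only [Finset.mem_erase] at hi
        rw [hxT j hj i (by simp [hi]), hxT l hl i (by simp [hi])]
  refine hne j hj (hC.eq_of_agree (hxC j hj) hc hT.ge fun i hi => ?_)
  by_cases hij : i = j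
  · rw [hxx, hxT l hl i (Finset.mem_erase.2 ⟨hij ▸ hjl, hi⟩)]
  · exact hxT j hj i (Finset.mem_erase.2 ⟨hij, hi⟩)
end

section
/- Let C be an (n,2)_q MDS code containing the zero word 0̄, with n = q + 1. Then the weight spectrum of C is W(C) = {n-1}; that is, every nonzero codeword has weight exactly n - 1 = q. -/
/-- Two words at Hamming distance at least `n - 1` agree in at most one coordinate. -/
theorem eq_of_agree_of_agree {A : Type*} [DecidableEq A] {n : ℕ}
    {C : Finset (Fin n → A)}
    (hC : ∀ x ∈ C, ∀ y ∈ C, x ≠ y → n - 2 + 1 ≤ hammingDist x y)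
    {x y : Fin n → A} (hx : x ∈ C) (hy : y ∈ C) {i j : Fin n} (hij : i ≠ j)
    (hi : x i = y i) (hj : x j = y j) : x = y := by
  by_contra hne
  have hle := hC x hx y hy hne
  have hsub : (Finset.univ.filter fun l => x l ≠ y l) ⊆ Finset.univ \ {i, j} := by
    intro l hl
    simp only [Finset.mem_filter, Finset.mem_univ, true_and] at hl
    simp only [Finset.mem_sdiff, Finset.mem_univ, Finset.mem_insert, Finset.mem_singleton,
      true_and, not_or]
    exact ⟨fun h => hl (h ▸ hi), fun h => hl (h ▸ hj)⟩
  have hcard := Finset.card_le_card hsub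
  rw [Finset.card_sdiff_of_subset (Finset.subset_univ _), Finset.card_pair hij,
    Finset.card_univ, Fintype.card_fin] at hcard
  unfold hammingDist at hle
  omega

/-- In a two-dimensional MDS code, any two coordinates can be prescribed freely. -/
theorem IsMDS.exists_mem_of_pair {A : Type*} [Fintype A] [DecidableEq A] {q n : ℕ}
    (hA : Fintype.card A = q) {C : Finset (Fin n → A)} (hC : IsMDS q 2 C)
    {i j : Fin n} (hij : i ≠ j) (a b : A) : ∃ c ∈ C, c i = a ∧ c j = b := by
  have hinj : Set.InjOn (fun c : Fin n → A => (c i, c j)) C := by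
    intro x hx y hy hxy
    obtain ⟨hi, hj⟩ := Prod.ext_iff.mp hxy
    exact eq_of_agree_of_agree hC.2.1 hx hy hij hi hj
  have huniv : C.image (fun c => (c i, c j)) = Finset.univ := by
    rw [← Finset.card_eq_iff_eq_univ, Finset.card_image_of_injOn hinj, hC.1,
      Fintype.card_prod, hA, sq]
  obtain ⟨c, hc, h⟩ := Finset.mem_image.mp (huniv ▸ Finset.mem_univ (a, b))
  exact ⟨c, hc, Prod.ext_iff.mp h⟩

/-- In an `(n,2)_q` MDS code with `n = q + 1`, any two codewords agree somewhere. -/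
theorem IsMDS.exists_agree {A : Type*} [Fintype A] [DecidableEq A] {q n : ℕ}
    (hq : 2 ≤ q) (hA : Fintype.card A = q) {C : Finset (Fin n → A)} (hC : IsMDS q 2 C)
    (hn : n = q + 1) {c d : Fin n → A} (hc : c ∈ C) (hd : d ∈ C) : ∃ i, c i = d i := by
  by_contra! hne
  let i₀ : Fin n := ⟨0, by omega⟩
  let i₁ : Fin n := ⟨1, by omega⟩
  have h01 : i₀ ≠ i₁ := by simp [i₀, i₁, Fin.ext_iff]
  have hex : ∀ j : Fin n, ∃ y ∈ C, j ≠ i₀ → y i₀ = c i₀ ∧ y j = d j := by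
    intro j
    by_cases hj : j = i₀
    · exact ⟨c, hc, fun h => absurd hj h⟩
    · obtain ⟨y, hy, h⟩ := hC.exists_mem_of_pair hA (Ne.symm hj) (c i₀) (d j)
      exact ⟨y, hy, fun _ => h⟩
  choose y hyC hy using hex
  have hcard : (Finset.univ.erase (c i₁)).card < (Finset.univ.erase i₀).card := by
    rw [Finset.card_erase_of_mem (Finset.mem_univ _), Finset.card_erase_of_mem (Finset.mem_univ _),
      Finset.card_univ, Finset.card_univ, hA, Fintype.card_fin]
    omega
  obtain ⟨j, hj, k, hk, hjk, heq⟩ := Finset.exists_ne_map_eq_of_card_lt_of_maps_to hcard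
    (f := fun j => y j i₁) (by
      intro j hj
      have hj0 : j ≠ i₀ := by simpa using hj
      have : y j i₁ ≠ c i₁ := fun h => by
        have hyc := eq_of_agree_of_agree hC.2.1 (hyC j) hc h01 (hy j hj0).1 h
        exact hne j (hyc ▸ (hy j hj0).2)
      simpa using this)
  obtain ⟨hj0, hjj⟩ := hy j (Finset.ne_of_mem_erase hj)
  obtain ⟨hk0, hkk⟩ := hy k (Finset.ne_of_mem_erase hk)
  have hyy := eq_of_agree_of_agree hC.2.1 (hyC j) (hyC k) h01 (hj0.trans hk0.symm) heq
  have hyd := eq_of_agree_of_agree hC.2.1 (hyC j) hd hjk hjj (hyy ▸ hkk)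
  exact hne i₀ (hj0.symm.trans (congrFun hyd i₀))

/-- an `(n,2)_q` MDS code containing the zero word, with
`n = q + 1`, has weight spectrum `{n-1}`. -/
theorem stmt_13 {A : Type*} [Fintype A] [DecidableEq A] {q n : ℕ}
    (hq : 2 ≤ q) (hA : Fintype.card A = q) (z : A)
    (C : Finset (Fin n → A)) (hC : IsMDS q 2 C)
    (h0 : (fun _ : Fin n => z) ∈ C) (hn : n = q + 1) :
    {w : ℕ | ∃ c ∈ C, c ≠ (fun _ : Fin n => z) ∧ wt z c = w} = {n - 1} := by
  have hwt : ∀ c ∈ C, c ≠ (fun _ : Fin n => z) → wt z c = n - 1 := by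
    intro c hc hne
    have hlow : n - 2 + 1 ≤ wt z c := hC.2.1 c hc _ h0 hne
    obtain ⟨i, hi⟩ := hC.exists_agree hq hA hn hc h0
    have hup : wt z c < n := by
      have := Finset.card_lt_univ_of_notMem
        (s := Finset.univ.filter fun i => c i ≠ z) (x := i) (by simpa using hi)
      rwa [Fintype.card_fin] at this
    omega
  have hone : 1 < C.card := by
    rw [hC.1]
    exact Nat.one_lt_pow two_ne_zero hq
  obtain ⟨c, hc, hne⟩ := Finset.exists_mem_ne hone (fun _ : Fin n => z)
  ext w
  constructor
  · rintro ⟨d, hd, hdz, rfl⟩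
    exact hwt d hd hdz
  · rintro rfl
    exact ⟨c, hc, hne, hwt c hc hne⟩
end

section
/- Let C be an (n,k)_q MDS code with n < q + k - 1, and let c ∈ C. Then for every i with 0 ≤ i ≤ k - 1 there exists a codeword x ∈ C with d(c, x) = n - i. -/
namespace IsMDS

variable {A : Type*} [DecidableEq A] {q n k : ℕ} {C : Finset (Fin n → A)}

theorem dim_pos (hC : IsMDS q k C) : 0 < k := by
  obtain ⟨hcard, -, x, hx, y, hy, hxy, -⟩ := hC
  by_contra! h
  obtain rfl : k = 0 := by omega
  exact hxy (Finset.card_le_one.1 (by simp [hcard]) x hx y hy)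

theorem dim_le_length [Fintype A] (hq : 2 ≤ q) (hA : Fintype.card A = q) (hC : IsMDS q k C) :
    k ≤ n := by
  have h := C.card_le_univ
  rw [hC.1, Fintype.card_fun, Fintype.card_fin, hA] at h
  exact (Nat.pow_le_pow_iff_right (by omega)).1 h

/-- Two codewords of an MDS code that agree on `k` coordinates are equal. -/
theorem eq_of_agree_s18 (hC : IsMDS q k C) (hkn : k ≤ n) {x y : Fin n → A} (hx : x ∈ C) (hy : y ∈ C)
    {S : Finset (Fin n)} (hS : k ≤ S.card) (h : ∀ j ∈ S, x j = y j) : x = y := by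
  by_contra hxy
  have hdist := hC.2.1 x hx y hy hxy
  have hle : hammingDist x y ≤ Sᶜ.card := by
    refine Finset.card_le_card fun j hj => ?_
    rw [Finset.mem_compl]
    exact fun hjS => (Finset.mem_filter.1 hj).2 (h j hjS)
  rw [Finset.card_compl, Fintype.card_fin] at hle
  omega

/-- Every pattern on the first `k` coordinates extends to a codeword of an MDS code. -/
theorem exists_extension [Fintype A] (hA : Fintype.card A = q) (hC : IsMDS q k C)
    (hkn : k ≤ n) (p : Fin n → A) : ∃ x ∈ C, ∀ j : Fin n, j.val < k → x j = p j := by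
  let f : C → Fin k → A := fun x j => x.1 (Fin.castLE hkn j)
  have hf : Function.Injective f := fun x y hxy => Subtype.ext <|
    hC.eq_of_agree_s18 hkn x.2 y.2 (S := Finset.univ.map (Fin.castLEEmb hkn)) (by simp) <| by
      intro j hj
      obtain ⟨l, -, rfl⟩ := Finset.mem_map.1 hj
      exact congrFun hxy l
  have hbij : Function.Bijective f :=
    (Fintype.bijective_iff_injective_and_card f).2 ⟨hf, by simp [hC.1, hA]⟩
  obtain ⟨x, hx⟩ := hbij.2 fun j => p (Fin.castLE hkn j)
  exact ⟨x.1, x.2, fun j hj => congrFun hx ⟨j, hj⟩⟩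

/-- If `n - k + 1 < q`, every pattern on the first `k - 1` coordinates extends to a codeword that
differs from a given word `c` in all remaining coordinates. -/
theorem exists_extension_ne [Fintype A] (hq : 2 ≤ q) (hA : Fintype.card A = q)
    (hC : IsMDS q k C) (hn : n < q + k - 1) (c p : Fin n → A) :
    ∃ x ∈ C, ∀ j : Fin n, if j.val < k - 1 then x j = p j else x j ≠ c j := by
  have hk := hC.dim_pos
  have hkn := hC.dim_le_length hq hA
  let l : Fin n := ⟨k - 1, by omega⟩
  choose f hfC hf using fun a => hC.exists_extension hA hkn (Function.update p l a)
  have hfl (a : A) : f a l = a := by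
    simpa using hf a l (Nat.sub_lt hk one_pos)
  have hfp (a : A) (j : Fin n) (hj : j.val < k - 1) : f a j = p j := by
    have hjl : j ≠ l := fun h => absurd (congrArg Fin.val h) (by simp only [l]; omega)
    simpa [hjl] using hf a j (by omega)
  by_contra! hcon
  have hagree (a : A) : ∃ j : Fin n, k - 1 ≤ j.val ∧ f a j = c j := by
    obtain ⟨j, hj⟩ := hcon (f a) (hfC a)
    split_ifs at hj with hjk
    · exact absurd (hfp a j hjk) hj
    · exact ⟨j, not_lt.1 hjk, not_not.1 hj⟩
  choose g hgk hg using hagree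
  have hginj : Function.Injective g := by
    intro a b hab
    have hcard : k ≤ (insert (g a) (Finset.Iio l)).card := by
      rw [Finset.card_insert_of_notMem, Fin.card_Iio]
      · simp only [l]; omega
      · simpa [l, Fin.le_def] using hgk a
    have hfab : f a = f b := by
      refine hC.eq_of_agree_s18 hkn (hfC a) (hfC b) hcard fun j hj => ?_
      rcases Finset.mem_insert.1 hj with rfl | hj
      · rw [hg a, hab, hg b]
      · have hjk : j.val < k - 1 := Fin.lt_def.1 (Finset.mem_Iio.1 hj)
        rw [hfp a j hjk, hfp b j hjk]
    rw [← hfl a, hfab, hfl b]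
  have hle := Finset.card_le_card_of_injOn (s := Finset.univ) (t := Finset.Ici l) g
    (fun a _ => by simpa [l, Fin.le_def] using hgk a) hginj.injOn
  rw [Finset.card_univ, hA, Fin.card_Ici] at hle
  simp only [l] at hle
  omega

end IsMDS

/-- in an `(n,k)_q` MDS code with `n < q + k - 1`, for every
codeword `c` and every `0 ≤ i ≤ k - 1` there is a codeword at distance `n - i`
from `c`. -/
theorem stmt_18 {A : Type*} [Fintype A] [DecidableEq A] {q n k : ℕ}
    (hq : 2 ≤ q) (hA : Fintype.card A = q)
    (C : Finset (Fin n → A)) (hC : IsMDS q k C) (hn : n < q + k - 1)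
    (c : Fin n → A) (hc : c ∈ C) :
    ∀ i : ℕ, i ≤ k - 1 → ∃ x ∈ C, hammingDist c x = n - i := by
  intro i hi
  have hk := hC.dim_pos
  have hkn := hC.dim_le_length hq hA
  have : Nontrivial A := Fintype.one_lt_card_iff_nontrivial.1 (by omega)
  choose b hb using fun a : A => exists_ne a
  obtain ⟨x, hx, hxp⟩ := hC.exists_extension_ne hq hA hn c
    fun j => if j.val < i then c j else b (c j)
  refine ⟨x, hx, ?_⟩
  have hiff (j : Fin n) : c j ≠ x j ↔ ¬ j.val < i := by
    have hj := hxp j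
    have hbj := hb (c j)
    grind
  have hset : (Finset.univ.filter fun j => c j ≠ x j) = Finset.Ici ⟨i, by omega⟩ := by
    ext j
    simp [hiff, Fin.le_def]
  rw [hammingDist, hset, Fin.card_Ici]
end
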